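/- Let n ≥ 1. There is a constant C depending only on n such that the following holds. Let μ be a positive Borel measure on ℝ^{n+1} with upper parabolic growth of degree n+1 with constant 1, i.e. μ(B_p(x̄,r)) ≤ r^{n+1} for all x̄ ∈ ℝ^{n+1} and r > 0. Then ‖W * μ‖_{Lip_{1/2,t}} ≤ C, i.e. |W*μ(x,t) − W*μ(x,u)| ≤ C |t−u|^{1/2} for all x ∈ ℝ^n and t, u ∈ ℝ. -/

import Mathlib

open MeasureTheory Real Set

noncomputable section

/-- The spatial factor `ℝⁿ`. -/
abbrev Spc (n : ℕ) := EuclideanSpace ℝ (Fin n)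

/-- The parabolic space `ℝ^{n+1} = ℝⁿ × ℝ`, points `x̄ = (x, t)`. -/
abbrev Pt (n : ℕ) := Spc n × ℝ

/-- The parabolic norm `|x̄|_p = max (|x|, |t|^{1/2})`. -/
def pnorm {n : ℕ} (p : Pt n) : ℝ := max ‖p.1‖ (Real.sqrt |p.2|)

/-- The parabolic ball of center `c` and radius `r`. -/
def pball {n : ℕ} (c : Pt n) (r : ℝ) : Set (Pt n) := {p | pnorm (p - c) < r}

/-- The heat kernel `W`. -/
def heatW {n : ℕ} (p : Pt n) : ℝ :=
  if 0 < p.2 then (4 * π * p.2) ^ (-(n : ℝ) / 2) * Real.exp (-‖p.1‖ ^ 2 / (4 * p.2)) else 0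

/-- The spatial gradient `∇ₓ W` of the heat kernel. -/
def gradW {n : ℕ} (p : Pt n) : Spc n :=
  if 0 < p.2 then
    (-(1 / (2 * p.2)) * (4 * π * p.2) ^ (-(n : ℝ) / 2) * Real.exp (-‖p.1‖ ^ 2 / (4 * p.2))) • p.1
  else 0

/-- Half time derivative `∂_t^{1/2} f (x,t) = ∫ (f(x,s) - f(x,t))/|s-t|^{3/2} ds`. -/
def halfT {n : ℕ} (f : Pt n → ℝ) (p : Pt n) : ℝ :=
  ∫ s : ℝ, (f (p.1, s) - f p) / |s - p.2| ^ (3 / 2 : ℝ)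

/-- A parabolic cube: product of `n` intervals of length `len` and a time interval
of length `len ^ 2`. -/
structure PCube (n : ℕ) where
  corner : Fin n → ℝ
  time : ℝ
  len : ℝ
  len_pos : 0 < len

/-- The set of points of a parabolic cube. -/
def PCube.toSet {n : ℕ} (Q : PCube n) : Set (Pt n) :=
  {p | (∀ i, p.1 i ∈ Set.Icc (Q.corner i) (Q.corner i + Q.len)) ∧
    p.2 ∈ Set.Icc Q.time (Q.time + Q.len ^ 2)}

/-- The dilation `λQ` of a parabolic cube: same center, side lengths `λ·len` and
`λ²·len²`. -/
def PCube.dilate {n : ℕ} (Q : PCube n) (lam : ℝ) (h : 0 < lam) : PCube n :=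
  ⟨fun i => Q.corner i + Q.len / 2 - lam * Q.len / 2,
    Q.time + Q.len ^ 2 / 2 - lam ^ 2 * Q.len ^ 2 / 2,
    lam * Q.len, mul_pos h Q.len_pos⟩

/-- Second directional derivative in the `i`-th spatial direction. -/
def dir2 {n : ℕ} (φ : Pt n → ℝ) (p : Pt n) (i : Fin n) : ℝ :=
  deriv (fun h : ℝ =>
    deriv (fun h' : ℝ => φ (p.1 + h' • (EuclideanSpace.single i 1 : Spc n), p.2)) h) 0

/-- Spatial Laplacian `Δₓ φ`. -/
def lapx {n : ℕ} (φ : Pt n → ℝ) (p : Pt n) : ℝ := ∑ i : Fin n, dir2 φ p i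

/-- A `C²` function `φ` is admissible for a parabolic cube `Q` if it is supported on `Q`,
`‖∇ₓ φ‖_∞ ≤ 1/ℓ(Q)` and `‖Δₓ φ‖_∞ + ‖∂_t φ‖_∞ ≤ 1/ℓ(Q)²`. -/
def Admissible {n : ℕ} (φ : Pt n → ℝ) (Q : PCube n) : Prop :=
  ContDiff ℝ 2 φ ∧ tsupport φ ⊆ Q.toSet ∧
  (∀ p : Pt n, ‖fderiv ℝ (fun y : Spc n => φ (y, p.2)) p.1‖ ≤ 1 / Q.len) ∧
  (∀ p : Pt n, |lapx φ p| + |deriv (fun s : ℝ => φ (p.1, s)) p.2| ≤ 1 / Q.len ^ 2)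

/-- The parabolic BMO norm of `f` is at most `C`. -/
def ParabBMOLe {n : ℕ} (f : Pt n → ℝ) (C : ℝ) : Prop :=
  ∀ Q : PCube n, ⨍ p in Q.toSet, |f p - ⨍ q in Q.toSet, f q| ≤ C

/-- `‖F‖_{Lip_{1/2,t}} ≤ C` : half-Lipschitz in time. -/
def LipHalfLe {n : ℕ} (F : Pt n → ℝ) (C : ℝ) : Prop :=
  ∀ (x : Spc n) (t u : ℝ), |F (x, t) - F (x, u)| ≤ C * Real.sqrt |t - u|

/-- Integral of a scalar function against a finite signed measure. -/
def sInt {n : ℕ} (ν : SignedMeasure (Pt n)) (f : Pt n → ℝ) : ℝ :=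
  ∫ y, f y ∂ν.toJordanDecomposition.posPart - ∫ y, f y ∂ν.toJordanDecomposition.negPart

/-- Integral of a vector-valued function against a finite signed measure. -/
def vInt {n : ℕ} (ν : SignedMeasure (Pt n)) (f : Pt n → Spc n) : Spc n :=
  ∫ y, f y ∂ν.toJordanDecomposition.posPart - ∫ y, f y ∂ν.toJordanDecomposition.negPart

/-- `W * ν`. -/
def convW {n : ℕ} (ν : SignedMeasure (Pt n)) (p : Pt n) : ℝ :=
  sInt ν (fun y => heatW (p - y))

/-- `∇ₓ W * ν`. -/
def convGradW {n : ℕ} (ν : SignedMeasure (Pt n)) (p : Pt n) : Spc n :=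
  vInt ν (fun y => gradW (p - y))

/-- `W * (φ ν)`, where `φν` is the measure with density `φ` w.r.t. `ν`. -/
def convWd {n : ℕ} (ν : SignedMeasure (Pt n)) (φ : Pt n → ℝ) (p : Pt n) : ℝ :=
  sInt ν (fun y => φ y * heatW (p - y))

/-- `∇ₓ W * (φ ν)`. -/
def convGradWd {n : ℕ} (ν : SignedMeasure (Pt n)) (φ : Pt n → ℝ) (p : Pt n) : Spc n :=
  vInt ν (fun y => φ y • gradW (p - y))

/-- `W * μ` for a positive measure `μ`. -/
def mconvW {n : ℕ} (μ : Measure (Pt n)) (p : Pt n) : ℝ := ∫ y, heatW (p - y) ∂μ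

/-- `∇ₓ W * μ` for a positive measure `μ`. -/
def mconvGradW {n : ℕ} (μ : Measure (Pt n)) (p : Pt n) : Spc n := ∫ y, gradW (p - y) ∂μ

/-- Upper parabolic growth of degree `n+1` with constant `1`. -/
def PGrowth {n : ℕ} (μ : Measure (Pt n)) : Prop :=
  ∀ (c : Pt n) (r : ℝ), 0 < r → μ (pball c r) ≤ ENNReal.ofReal (r ^ (n + 1))
lemma pnorm_nonneg' {n : ℕ} (p : Pt n) : 0 ≤ pnorm p := le_max_of_le_left (norm_nonneg _)

lemma pnorm_neg' {n : ℕ} (p : Pt n) : pnorm (-p) = pnorm p := by simp [pnorm]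

lemma pnorm_symm' {n : ℕ} (p q : Pt n) : pnorm (p - q) = pnorm (q - p) := by
  rw [← pnorm_neg', neg_sub]

lemma pnorm_cont {n : ℕ} : Continuous (pnorm : Pt n → ℝ) := by
  unfold pnorm; fun_prop

lemma pball_meas {n : ℕ} (c : Pt n) (r : ℝ) : MeasurableSet (pball c r) := by
  have : IsOpen (pball c r) :=
    isOpen_lt (pnorm_cont.comp (continuous_id.sub continuous_const)) continuous_const
  exact this.measurableSet

lemma heatW_meas {n : ℕ} : Measurable (heatW : Pt n → ℝ) := by
  unfold heatW
  refine Measurable.ite (measurableSet_lt measurable_const measurable_snd) ?_ measurable_const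
  fun_prop

lemma heatW_nonneg {n : ℕ} (p : Pt n) : 0 ≤ heatW p := by
  unfold heatW
  split_ifs with h
  · have := Real.pi_pos
    positivity
  · exact le_rfl

/-- Dyadic summation. -/
lemma dyadic_sum {n : ℕ} (μ : Measure (Pt n)) (hμ : PGrowth μ) (c : Pt n) (S : Set (Pt n))
    (hS : MeasurableSet S) (f : Pt n → ℝ) (ρ a : ℕ → ℝ) (M : ℝ) (hM : 0 ≤ M)
    (hρ : ∀ k, 0 < ρ k) (ha : ∀ k, 0 ≤ a k)
    (hf : ∀ y ∈ S, ∃ k, y ∈ pball c (ρ k) ∧ f y ≤ a k)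
    (hs : ∀ k, a k * ρ k ^ (n + 1) ≤ M * (1 / 2) ^ k) :
    ∫⁻ y in S, ENNReal.ofReal (f y) ∂μ ≤ ENNReal.ofReal (2 * M) := by
  calc ∫⁻ y in S, ENNReal.ofReal (f y) ∂μ
      ≤ ∫⁻ y in S, ∑' k, (pball c (ρ k)).indicator (fun _ => ENNReal.ofReal (a k)) y ∂μ := by
        refine setLIntegral_mono' hS fun y hy => ?_
        obtain ⟨k, hk, hk'⟩ := hf y hy
        refine le_trans ?_ (ENNReal.le_tsum k)
        rw [indicator_of_mem hk]
        exact ENNReal.ofReal_le_ofReal hk'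
    _ ≤ ∫⁻ y, ∑' k, (pball c (ρ k)).indicator (fun _ => ENNReal.ofReal (a k)) y ∂μ :=
        setLIntegral_le_lintegral _ _
    _ = ∑' k, ENNReal.ofReal (a k) * μ (pball c (ρ k)) := by
        rw [lintegral_tsum fun k => (measurable_const.indicator (pball_meas c _)).aemeasurable]
        congr 1; ext k
        rw [lintegral_indicator_const (pball_meas c _)]
    _ ≤ ∑' k : ℕ, ENNReal.ofReal (M * (1 / 2) ^ k) := by
        refine ENNReal.tsum_le_tsum fun k => ?_
        refine (mul_le_mul_right (hμ c (ρ k) (hρ k)) _).trans ?_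
        rw [← ENNReal.ofReal_mul (ha k)]
        exact ENNReal.ofReal_le_ofReal (hs k)
    _ = ENNReal.ofReal (2 * M) := by
        rw [← ENNReal.ofReal_tsum_of_nonneg (fun k => by positivity)
          (summable_geometric_two.mul_left M), tsum_mul_left, tsum_geometric_two, mul_comm]

lemma near_int {n : ℕ} (hn : 1 ≤ n) (μ : Measure (Pt n)) (hμ : PGrowth μ) (c : Pt n) (R : ℝ)
    (hR : 0 < R) :
    ∫⁻ y in pball c R, ENNReal.ofReal ((pnorm (y - c) ^ n)⁻¹) ∂μ
      ≤ ENNReal.ofReal (2 * (2 ^ n * 2 ^ (n + 1) * R)) := by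
  refine dyadic_sum μ hμ c _ (pball_meas c R) _ (fun k => 2 * (R * (1 / 2) ^ k))
    (fun k => ((R * (1 / 2) ^ (k + 1)) ^ n)⁻¹) (2 ^ n * 2 ^ (n + 1) * R) (by positivity)
    (fun k => by positivity) (fun k => by positivity) ?_ ?_
  · intro y hy
    have hy : pnorm (y - c) < R := hy
    rcases (pnorm_nonneg' (y - c)).eq_or_lt with h0 | h0
    · refine ⟨0, ?_, ?_⟩
      · have : pnorm (y - c) < 2 * (R * (1 / 2) ^ 0) := by rw [pow_zero]; linarith
        exact this
      · rw [← h0, zero_pow (by omega), inv_zero]; positivity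
    · obtain ⟨k, hk1, hk2⟩ := exists_nat_pow_near_of_lt_one (x := pnorm (y - c) / R)
        (y := (1 / 2 : ℝ)) (by positivity) (by rw [div_le_one hR]; exact hy.le)
        (by norm_num) (by norm_num)
      rw [lt_div_iff₀' hR] at hk1
      rw [div_le_iff₀' hR] at hk2
      refine ⟨k, ?_, by gcongr⟩
      have h3 : pnorm (y - c) < 2 * (R * (1 / 2) ^ k) := by
        have : 0 < R * (1 / 2) ^ k := by positivity
        linarith
      exact h3
  · intro k
    have : ((R * (1 / 2) ^ (k + 1)) ^ n)⁻¹ * (2 * (R * (1 / 2) ^ k)) ^ (n + 1)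
        = 2 ^ n * 2 ^ (n + 1) * R * (1 / 2) ^ k := by
      rw [mul_pow 2, pow_succ (1 / 2 : ℝ) k, pow_succ (R * (1 / 2) ^ k) n, ← mul_assoc,
        ← mul_assoc R, mul_pow _ (1 / 2 : ℝ) n, one_div_pow 2 n]
      field_simp
    exact this.le

lemma far_int {n : ℕ} (μ : Measure (Pt n)) (hμ : PGrowth μ) (c : Pt n) (R : ℝ)
    (hR : 0 < R) :
    ∫⁻ y in (pball c R)ᶜ, ENNReal.ofReal ((pnorm (y - c) ^ (n + 2))⁻¹) ∂μ
      ≤ ENNReal.ofReal (2 * (2 ^ (n + 1) / R)) := by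
  refine dyadic_sum μ hμ c _ (pball_meas c R).compl _ (fun k => R * 2 ^ (k + 1))
    (fun k => ((R * 2 ^ k) ^ (n + 2))⁻¹) (2 ^ (n + 1) / R) (by positivity)
    (fun k => by positivity) (fun k => by positivity) ?_ ?_
  · intro y hy
    have hy : R ≤ pnorm (y - c) := not_lt.1 hy
    obtain ⟨k, hk1, hk2⟩ := exists_nat_pow_near (x := pnorm (y - c) / R)
        (y := (2 : ℝ)) (by rw [one_le_div hR]; exact hy) (by norm_num)
    rw [le_div_iff₀' hR] at hk1
    rw [div_lt_iff₀' hR] at hk2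
    exact ⟨k, hk2, by gcongr⟩
  · intro k
    have : ((R * 2 ^ k) ^ (n + 2))⁻¹ * (R * 2 ^ (k + 1)) ^ (n + 1)
        = 2 ^ (n + 1) / R * (1 / 2) ^ k := by
      rw [pow_succ (2 : ℝ) k, pow_succ (R * 2 ^ k) (n + 1), ← mul_assoc R (2 ^ k) 2,
        mul_pow _ (2 : ℝ) (n + 1), one_div_pow 2 k]
      field_simp
    exact this.le

lemma exp_dec_bound (a : ℝ) (ha : 0 ≤ a) (k : ℕ) :
    (1 + a) ^ k * Real.exp (-a) ≤ k.factorial * Real.exp 1 := by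
  have h := Real.pow_div_factorial_le_exp (1 + a) (by linarith) k
  rw [div_le_iff₀ (by positivity)] at h
  calc (1 + a) ^ k * Real.exp (-a) ≤ (Real.exp (1 + a) * k.factorial) * Real.exp (-a) := by gcongr
    _ = k.factorial * (Real.exp (1 + a) * Real.exp (-a)) := by ring
    _ = _ := by rw [← Real.exp_add]; ring_nf

lemma heatW_le' {n : ℕ} (x : Spc n) (τ : ℝ) (hτ : 0 < τ) :
    heatW (x, τ) ≤ (Real.sqrt τ ^ n)⁻¹ * Real.exp (-(‖x‖ ^ 2 / (4 * τ))) := by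
  have hp := Real.pi_gt_three
  simp only [heatW, hτ, if_true]
  have h1 : (4 * π * τ) ^ (-(n : ℝ) / 2) ≤ (Real.sqrt τ ^ n)⁻¹ := by
    have : (Real.sqrt τ ^ n)⁻¹ = τ ^ (-(n : ℝ) / 2) := by
      rw [neg_div, Real.rpow_neg hτ.le, ← Real.rpow_natCast, Real.sqrt_eq_rpow,
        ← Real.rpow_mul hτ.le]
      ring_nf
    rw [this]
    refine Real.rpow_le_rpow_of_nonpos hτ (by nlinarith) ?_
    have : (0 : ℝ) ≤ n := by positivity
    linarith
  rw [← neg_div (4 * τ) (‖x‖ ^ 2)]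
  exact mul_le_mul_of_nonneg_right h1 (Real.exp_pos _).le

lemma pnorm_le' {n : ℕ} (x : Spc n) (τ : ℝ) (hτ : 0 < τ) :
    pnorm (x, τ) ≤ 2 * Real.sqrt τ * (1 + ‖x‖ ^ 2 / (4 * τ)) := by
  set a := ‖x‖ ^ 2 / (4 * τ) with ha
  have ha0 : 0 ≤ a := by positivity
  have hx : ‖x‖ ^ 2 = 4 * τ * a := by rw [ha]; field_simp
  have hs := Real.sq_sqrt hτ.le
  have hs0 := Real.sqrt_pos.2 hτ
  refine max_le ?_ ?_
  · refine abs_le_of_sq_le_sq' ?_ (by positivity) |>.2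
    rw [mul_pow, mul_pow, hs, hx]
    nlinarith [mul_nonneg hτ.le ha0, mul_nonneg hτ.le (sq_nonneg a)]
  · simp only [abs_of_pos hτ]
    nlinarith [mul_nonneg hs0.le ha0]

/-- Size bound. -/
lemma heatW_size (n : ℕ) : ∃ A : ℝ, 0 < A ∧ ∀ z : Pt n,
    heatW z ≤ A * (pnorm z ^ n)⁻¹ := by
  refine ⟨2 ^ n * (n.factorial * Real.exp 1), by positivity, ?_⟩
  rintro ⟨x, τ⟩
  by_cases hτ : 0 < τ
  swap
  · simp only [heatW, hτ, if_false]
    have := pnorm_nonneg' (x, τ)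
    positivity
  have hs0 := Real.sqrt_pos.2 hτ
  have hp : 0 < pnorm (x, τ) := by
    refine lt_max_of_lt_right ?_
    simpa [abs_of_pos hτ] using hτ
  rw [← div_eq_mul_inv, le_div_iff₀ (by positivity)]
  have h1 := heatW_le' x τ hτ
  have h2 := pnorm_le' x τ hτ
  set a := ‖x‖ ^ 2 / (4 * τ) with ha
  have ha0 : 0 ≤ a := by positivity
  calc heatW (x, τ) * pnorm (x, τ) ^ n
      ≤ ((Real.sqrt τ ^ n)⁻¹ * Real.exp (-a)) * (2 * Real.sqrt τ * (1 + a)) ^ n := by gcongr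
    _ = 2 ^ n * ((1 + a) ^ n * Real.exp (-a)) := by
        rw [mul_pow, mul_pow]; field_simp
    _ ≤ _ := mul_le_mul_of_nonneg_left (exp_dec_bound a ha0 n) (by positivity)

lemma heatW_size2 (n : ℕ) : ∃ K : ℝ, 0 < K ∧ ∀ (x : Spc n) (τ : ℝ), 0 < τ →
    heatW (x, τ) * (1 + ‖x‖ ^ 2 / (4 * τ)) / τ ≤ K * (pnorm (x, τ) ^ (n + 2))⁻¹ := by
  refine ⟨2 ^ (n + 2) * ((n + 3).factorial * Real.exp 1), by positivity, ?_⟩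
  intro x τ hτ
  have hs0 := Real.sqrt_pos.2 hτ
  have hp : 0 < pnorm (x, τ) := by
    refine lt_max_of_lt_right ?_
    simpa [abs_of_pos hτ] using hτ
  rw [← div_eq_mul_inv, le_div_iff₀ (by positivity)]
  have h1 := heatW_le' x τ hτ
  have h2 := pnorm_le' x τ hτ
  set a := ‖x‖ ^ 2 / (4 * τ) with ha
  have ha0 : 0 ≤ a := by positivity
  have hs := Real.sq_sqrt hτ.le
  calc heatW (x, τ) * (1 + a) / τ * pnorm (x, τ) ^ (n + 2)
      ≤ ((Real.sqrt τ ^ n)⁻¹ * Real.exp (-a)) * (1 + a) / τ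
          * (2 * Real.sqrt τ * (1 + a)) ^ (n + 2) := by gcongr
    _ = ((Real.sqrt τ ^ n)⁻¹ * Real.exp (-a)) * (1 + a) / (Real.sqrt τ ^ 2)
          * (2 * Real.sqrt τ * (1 + a)) ^ (n + 2) := by rw [hs]
    _ = 2 ^ (n + 2) * ((1 + a) ^ (n + 3) * Real.exp (-a)) := by
        rw [mul_pow, mul_pow]; field_simp; ring
    _ ≤ _ := mul_le_mul_of_nonneg_left (exp_dec_bound a ha0 (n + 3)) (by positivity)

lemma heatW_deriv {n : ℕ} (x : Spc n) (τ : ℝ) (hτ : 0 < τ) :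
    HasDerivAt (fun s => heatW (x, s))
      (heatW (x, τ) * (-(n : ℝ) / 2 + ‖x‖ ^ 2 / (4 * τ)) / τ) τ := by
  have hpi := Real.pi_pos
  have h1 : HasDerivAt (fun s : ℝ => (4 * π * s) ^ (-(n : ℝ) / 2) *
      Real.exp (-‖x‖ ^ 2 / (4 * s)))
      (heatW (x, τ) * (-(n : ℝ) / 2 + ‖x‖ ^ 2 / (4 * τ)) / τ) τ := by
    have e1 : HasDerivAt (fun s : ℝ => 4 * π * s) (4 * π) τ := by
      simpa using (hasDerivAt_id τ).const_mul (4 * π)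
    have e2 := e1.rpow_const (p := -(n : ℝ) / 2) (Or.inl (by positivity))
    have e3 : HasDerivAt (fun s : ℝ => 4 * s) 4 τ := by
      simpa using (hasDerivAt_id τ).const_mul 4
    have e4 := ((hasDerivAt_const τ (-‖x‖ ^ 2)).fun_div e3 (by positivity)).exp
    refine (e2.fun_mul e4).congr_deriv ?_
    simp only [heatW, hτ, if_true]
    rw [Real.rpow_sub_one (by positivity)]
    field_simp
    ring
  refine h1.congr_of_eventuallyEq ?_
  filter_upwards [lt_mem_nhds hτ] with s hs
  simp [heatW, hs]

/-- Smoothness bound. -/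
lemma heatW_smooth (n : ℕ) : ∃ B : ℝ, 0 < B ∧ ∀ (x : Spc n) (τ h : ℝ), 0 < h →
    2 * Real.sqrt h ≤ pnorm (x, τ) →
    |heatW (x, τ + h) - heatW (x, τ)| ≤ B * h * (pnorm (x, τ) ^ (n + 2))⁻¹ := by
  obtain ⟨K, hK, H⟩ := heatW_size2 n
  refine ⟨(n + 1) * K, by positivity, ?_⟩
  intro x τ h hh hfar
  have hsh := Real.sqrt_pos.2 hh
  have hp : 0 < pnorm (x, τ) := by linarith
  by_cases hτ : 0 < τ
  · have mono : ∀ s ∈ Icc τ (τ + h), pnorm (x, τ) ≤ pnorm (x, s) := by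
      intro s hs
      refine max_le_max le_rfl (Real.sqrt_le_sqrt ?_)
      simp only
      rw [abs_of_pos hτ, abs_of_pos (hτ.trans_le hs.1)]; exact hs.1
    have key := (convex_Icc τ (τ + h)).norm_image_sub_le_of_norm_hasDerivWithin_le
      (f := fun s => heatW (x, s))
      (f' := fun s => heatW (x, s) * (-(n : ℝ) / 2 + ‖x‖ ^ 2 / (4 * s)) / s)
      (C := (n + 1) * K * (pnorm (x, τ) ^ (n + 2))⁻¹) (x := τ) (y := τ + h)
      (fun s hs => (heatW_deriv x s (hτ.trans_le hs.1)).hasDerivWithinAt) ?_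
      ⟨le_rfl, by linarith⟩ ⟨by linarith, le_rfl⟩
    · simp only [Real.norm_eq_abs, add_sub_cancel_left, abs_of_pos hh] at key
      linarith
    · intro s hs
      have hs0 : 0 < s := hτ.trans_le hs.1
      have hW := heatW_nonneg (x, s)
      have ha0 : 0 ≤ ‖x‖ ^ 2 / (4 * s) := by positivity
      rw [Real.norm_eq_abs, abs_div, abs_mul, abs_of_nonneg hW, abs_of_pos hs0]
      have hb : |(-(n : ℝ) / 2 + ‖x‖ ^ 2 / (4 * s))| ≤ (n + 1) * (1 + ‖x‖ ^ 2 / (4 * s)) := by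
        have : (0 : ℝ) ≤ n := by positivity
        rw [abs_le]
        constructor <;> nlinarith [mul_nonneg this ha0]
      calc heatW (x, s) * |(-(n : ℝ) / 2 + ‖x‖ ^ 2 / (4 * s))| / s
          ≤ heatW (x, s) * ((n + 1) * (1 + ‖x‖ ^ 2 / (4 * s))) / s := by gcongr
        _ = (n + 1) * (heatW (x, s) * (1 + ‖x‖ ^ 2 / (4 * s)) / s) := by ring
        _ ≤ (n + 1) * (K * (pnorm (x, s) ^ (n + 2))⁻¹) := by gcongr; exact H x s hs0
        _ ≤ (n + 1) * (K * (pnorm (x, τ) ^ (n + 2))⁻¹) := by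
            gcongr; exact mono s hs
        _ = _ := by ring
  · have h0 : heatW (x, τ) = 0 := by simp [heatW, hτ]
    rw [h0, sub_zero, abs_of_nonneg (heatW_nonneg _)]
    by_cases hτh : 0 < τ + h
    swap
    · have : heatW (x, τ + h) = 0 := by simp [heatW, hτh]
      rw [this]; positivity
    have hxp : pnorm (x, τ) ≤ pnorm (x, τ + h) := by
      refine le_trans ?_ (le_max_left _ _)
      have hlt : Real.sqrt |τ| < pnorm (x, τ) := by
        have : Real.sqrt |τ| ≤ Real.sqrt h := by
          apply Real.sqrt_le_sqrt
          rw [abs_of_nonpos (not_lt.1 hτ)]; linarith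
        linarith
      rcases max_choice ‖x‖ (Real.sqrt |τ|) with h' | h'
      · exact h'.le
      · exact absurd h' hlt.ne'
    have hW := heatW_nonneg (x, τ + h)
    have h1 := H x _ hτh
    have ha0 : 0 ≤ ‖x‖ ^ 2 / (4 * (τ + h)) := by positivity
    have hn0 : (0 : ℝ) ≤ n := by positivity
    rw [div_le_iff₀ hτh] at h1
    calc heatW (x, τ + h) ≤ heatW (x, τ + h) * (1 + ‖x‖ ^ 2 / (4 * (τ + h))) := by
          nlinarith [mul_nonneg hW ha0]
      _ ≤ K * (pnorm (x, τ + h) ^ (n + 2))⁻¹ * (τ + h) := h1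
      _ ≤ K * (pnorm (x, τ) ^ (n + 2))⁻¹ * h := by
          gcongr
          linarith [not_lt.1 hτ]
      _ = 1 * (K * (pnorm (x, τ) ^ (n + 2))⁻¹ * h) := by ring
      _ ≤ (n + 1) * (K * (pnorm (x, τ) ^ (n + 2))⁻¹ * h) := by
          gcongr; linarith
      _ = _ := by ring

/-- Lemma 4.2: a positive measure with upper parabolic growth of degree
`n+1` has `W*μ` half-Lipschitz in time. -/
theorem mconvW_lipHalf (n : ℕ) (hn : 1 ≤ n) :
    ∃ C : ℝ, 0 < C ∧ ∀ μ : Measure (Pt n), PGrowth μ →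
      LipHalfLe (mconvW μ) C := by
  obtain ⟨A, hA, HA⟩ := heatW_size n
  obtain ⟨B, hB, HB⟩ := heatW_smooth n
  set C : ℝ := A * (2 * (2 ^ n * 2 ^ (n + 1) * 3)) + A * (2 * (2 ^ n * 2 ^ (n + 1) * 2)) + B * (2 * (2 ^ (n + 1) / 2)) with hC
  have hC0 : 0 < C := by positivity
  refine ⟨C, hC0, fun μ hμ => ?_⟩
  have main : ∀ (x : Spc n) (t u : ℝ), u < t →
      |mconvW μ (x, t) - mconvW μ (x, u)| ≤ C * Real.sqrt |t - u| := by
    intro x t u hut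
    set h := t - u with hh
    have hpos : 0 < h := by linarith
    rw [abs_of_pos hpos]
    set r := Real.sqrt h with hr
    have hr0 : 0 < r := Real.sqrt_pos.2 hpos
    have hrsq : r ^ 2 = h := Real.sq_sqrt hpos.le
    set p : Pt n := (x, t) with hp
    set q : Pt n := (x, u) with hq
    have mp : Measurable fun y => heatW (p - y) := heatW_meas.comp (measurable_const.sub measurable_id)
    have mq : Measurable fun y => heatW (q - y) := heatW_meas.comp (measurable_const.sub measurable_id)
    have bnd : ∫⁻ y, ENNReal.ofReal |heatW (p - y) - heatW (q - y)| ∂μ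
        ≤ ENNReal.ofReal (C * r) := by
      rw [← lintegral_add_compl _ (pball_meas q (2 * r))]
      have near : ∫⁻ y in pball q (2 * r), ENNReal.ofReal |heatW (p - y) - heatW (q - y)| ∂μ
          ≤ ENNReal.ofReal A * ENNReal.ofReal (2 * (2 ^ n * 2 ^ (n + 1) * (3 * r)))
            + ENNReal.ofReal A * ENNReal.ofReal (2 * (2 ^ n * 2 ^ (n + 1) * (2 * r))) := by
        have hsub : pball q (2 * r) ⊆ pball p (3 * r) := by
          intro y hy
          have hy : pnorm (y - q) < 2 * r := hy
          obtain ⟨h1, h2⟩ := max_lt_iff.1 (show max ‖(y - q).1‖ (Real.sqrt |(y - q).2|) < 2 * r from hy)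
          show max ‖(y - p).1‖ (Real.sqrt |(y - p).2|) < 3 * r
          refine max_lt ?_ ?_
          · simp only [hp, hq, Prod.fst_sub] at h1 ⊢
            linarith
          · simp only [hp, hq, Prod.snd_sub] at h2 ⊢
            rw [Real.sqrt_lt' (by positivity)] at h2 ⊢
            rw [abs_lt] at h2 ⊢
            constructor <;> nlinarith
        have m1 : Measurable fun y : Pt n => ENNReal.ofReal ((pnorm (y - p) ^ n)⁻¹) := by
          have := (pnorm_cont (n := n)).measurable.comp (measurable_id.sub_const p)
          exact (this.pow_const n).inv.ennreal_ofReal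
        have m2 : Measurable fun y : Pt n => ENNReal.ofReal ((pnorm (y - q) ^ n)⁻¹) := by
          have := (pnorm_cont (n := n)).measurable.comp (measurable_id.sub_const q)
          exact (this.pow_const n).inv.ennreal_ofReal
        calc _ ≤ ∫⁻ y in pball q (2 * r), (ENNReal.ofReal A * ENNReal.ofReal ((pnorm (y - p) ^ n)⁻¹)
              + ENNReal.ofReal A * ENNReal.ofReal ((pnorm (y - q) ^ n)⁻¹)) ∂μ := by
              refine lintegral_mono fun y => ?_
              have e1 := pnorm_nonneg' (y - p)
              have e2 := pnorm_nonneg' (y - q)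
              rw [← ENNReal.ofReal_mul hA.le, ← ENNReal.ofReal_mul hA.le,
                ← ENNReal.ofReal_add (by positivity) (by positivity)]
              refine ENNReal.ofReal_le_ofReal ?_
              have a1 := HA (p - y)
              have a2 := HA (q - y)
              rw [pnorm_symm'] at a1 a2
              have b1 := heatW_nonneg (p - y)
              have b2 := heatW_nonneg (q - y)
              rw [abs_le]; constructor <;> linarith
          _ = ENNReal.ofReal A * (∫⁻ y in pball q (2 * r), ENNReal.ofReal ((pnorm (y - p) ^ n)⁻¹) ∂μ)
              + ENNReal.ofReal A *
                (∫⁻ y in pball q (2 * r), ENNReal.ofReal ((pnorm (y - q) ^ n)⁻¹) ∂μ) := by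
              rw [lintegral_add_left (m1.const_mul _), lintegral_const_mul _ m1,
                lintegral_const_mul _ m2]
          _ ≤ _ := by
              gcongr
              · exact (lintegral_mono_set hsub).trans (near_int hn μ hμ p (3 * r) (by positivity))
              · exact near_int hn μ hμ q (2 * r) (by positivity)
      have far : ∫⁻ y in (pball q (2 * r))ᶜ, ENNReal.ofReal |heatW (p - y) - heatW (q - y)| ∂μ
          ≤ ENNReal.ofReal (B * h) * ENNReal.ofReal (2 * (2 ^ (n + 1) / (2 * r))) := by
        have m2 : Measurable fun y : Pt n => ENNReal.ofReal ((pnorm (y - q) ^ (n + 2))⁻¹) := by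
          have := (pnorm_cont (n := n)).measurable.comp (measurable_id.sub_const q)
          exact (this.pow_const (n + 2)).inv.ennreal_ofReal
        calc _ ≤ ∫⁻ y in (pball q (2 * r))ᶜ,
              ENNReal.ofReal (B * h) * ENNReal.ofReal ((pnorm (y - q) ^ (n + 2))⁻¹) ∂μ := by
              refine setLIntegral_mono' (pball_meas q _).compl fun y hy => ?_
              have hy : 2 * r ≤ pnorm (y - q) := not_lt.1 hy
              rw [pnorm_symm'] at hy ⊢
              rw [← ENNReal.ofReal_mul (by positivity)]
              refine ENNReal.ofReal_le_ofReal ?_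
              have := HB (x - y.1) (u - y.2) h hpos hy
              have e : (x - y.1, u - y.2 + h) = p - y := by
                ext1
                · rfl
                · simp only [hp, hh, Prod.snd_sub]; ring
              rw [e] at this
              exact this
          _ = ENNReal.ofReal (B * h) * _ := lintegral_const_mul _ m2
          _ ≤ _ := by gcongr; exact far_int μ hμ q (2 * r) (by positivity)
      refine (add_le_add near far).trans ?_
      rw [← ENNReal.ofReal_mul hA.le, ← ENNReal.ofReal_mul hA.le,
        ← ENNReal.ofReal_mul (by positivity), ← ENNReal.ofReal_add (by positivity) (by positivity),
        ← ENNReal.ofReal_add (by positivity) (by positivity)]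
      refine ENNReal.ofReal_le_ofReal (le_of_eq ?_)
      rw [hC, ← hrsq]
      field_simp
      try ring
    have hint : Integrable (fun y => heatW (p - y) - heatW (q - y)) μ := by
      refine ⟨(mp.sub mq).aestronglyMeasurable, ?_⟩
      rw [hasFiniteIntegral_iff_norm]
      exact bnd.trans_lt ENNReal.ofReal_lt_top
    have habs : |∫ y, (heatW (p - y) - heatW (q - y)) ∂μ| ≤ C * r := by
      have := norm_integral_le_lintegral_norm (μ := μ) (fun y => heatW (p - y) - heatW (q - y))
      refine this.trans ?_
      exact ENNReal.toReal_le_of_le_ofReal (by positivity) bnd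
    unfold mconvW
    by_cases hi : Integrable (fun y => heatW (q - y)) μ
    · have hi' : Integrable (fun y => heatW (p - y)) μ := by
        refine (hint.add hi).congr (Filter.Eventually.of_forall fun y => ?_)
        simp
      rw [← integral_sub hi' hi]; exact habs
    · have hi' : ¬ Integrable (fun y => heatW (p - y)) μ := by
        intro hi'
        apply hi
        refine (hi'.sub hint).congr (Filter.Eventually.of_forall fun y => ?_)
        simp
      rw [integral_undef hi, integral_undef hi', sub_zero, abs_zero]
      positivity
  intro x t u
  rcases lt_trichotomy u t with h | h | h
  · exact main x t u h
  · simp [h]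
  · rw [abs_sub_comm, abs_sub_comm t u]; exact main x u t h
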